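/- Let E and F be bounded operators on a Banach space with g-Drazin inverses satisfying F^π E F^2 = 0 and F^π E F E = 0, and assume E F^π has a g-Drazin inverse. Then the matrix M' = [[E, F], [I, 0]] has a g-Drazin inverse, and (M')^d = [[E, I], [I, 0]] · ([[E, I], [F, 0]])^d · [[0, I], [I, −E]]. -/

import Mathlib

open Filter Topology

/-- An element of a normed ring is quasinilpotent if `‖a^n‖^(1/n) → 0`. -/
def IsQuasinilpotent {A : Type*} [NormedRing A] (a : A) : Prop :=
  Filter.Tendsto (fun n : ℕ => ‖a ^ n‖ ^ ((1 : ℝ) / n)) Filter.atTop (nhds 0)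

/-- `b` is a generalized Drazin inverse of `a`. -/
def IsGDrazinInverse {A : Type*} [NormedRing A] (a b : A) : Prop :=
  a * b = b * a ∧ b * a * b = b ∧ IsQuasinilpotent (a - a ^ 2 * b)

/-- The block operator matrix `[[a, b], [c, d]]` acting on `X × X`. -/
noncomputable def blk {X : Type*} [NormedAddCommGroup X] [NormedSpace ℂ X]
    (a b c d : X →L[ℂ] X) : (X × X) →L[ℂ] (X × X) :=
  ((a.comp (ContinuousLinearMap.fst ℂ X X)) + (b.comp (ContinuousLinearMap.snd ℂ X X))).prod
    ((c.comp (ContinuousLinearMap.fst ℂ X X)) + (d.comp (ContinuousLinearMap.snd ℂ X X)))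

section aux
variable {A : Type*} [NormedRing A]

lemma qn_iff (a : A) : IsQuasinilpotent a ↔
    ∀ ε : ℝ, 0 < ε → ∀ᶠ n : ℕ in atTop, ‖a ^ n‖ ≤ ε ^ n := by
  unfold IsQuasinilpotent
  constructor
  · intro h ε hε
    filter_upwards [h.eventually (gt_mem_nhds hε), eventually_gt_atTop 0] with n hn hn0
    have h0 : (0:ℝ) ≤ ‖a ^ n‖ := norm_nonneg _
    have : (‖a ^ n‖ ^ ((1 : ℝ) / n)) ^ n = ‖a ^ n‖ := by
      rw [one_div]; exact Real.rpow_inv_natCast_pow h0 hn0.ne'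
    rw [← this]
    exact pow_le_pow_left₀ (Real.rpow_nonneg h0 _) hn.le n
  · intro h
    rw [Metric.tendsto_nhds]
    intro ε hε
    filter_upwards [h (ε / 2) (by positivity), eventually_gt_atTop 0] with n hn hn0
    have h0 : (0:ℝ) ≤ ‖a ^ n‖ := norm_nonneg _
    rw [Real.dist_eq, sub_zero, abs_of_nonneg (Real.rpow_nonneg h0 _)]
    have : ‖a ^ n‖ ^ ((1 : ℝ) / n) ≤ ((ε / 2) ^ n) ^ ((1 : ℝ) / n) :=
      Real.rpow_le_rpow h0 hn (by positivity)
    rw [one_div, Real.pow_rpow_inv_natCast (by positivity) hn0.ne'] at this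
    rw [one_div]
    linarith

/-- A bound up to constants suffices. -/
lemma qn_of_bound (a : A)
    (h : ∀ ε : ℝ, 0 < ε → ε < 1 → ∃ C : ℝ, ∀ᶠ n : ℕ in atTop, ‖a ^ n‖ ≤ C * ε ^ n) :
    IsQuasinilpotent a := by
  rw [qn_iff]
  intro ε hε
  obtain ⟨C, hC⟩ := h (min (ε / 2) (1/2)) (by positivity) (by
    refine lt_of_le_of_lt (min_le_right _ _) (by norm_num))
  have ht : ∀ᶠ n : ℕ in atTop, |C| * (1/2 : ℝ) ^ n < 1 := by
    have := (tendsto_pow_atTop_nhds_zero_of_lt_one (r := (1/2:ℝ)) (by norm_num)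
      (by norm_num)).const_mul |C|
    rw [mul_zero] at this
    exact this.eventually (gt_mem_nhds one_pos)
  filter_upwards [hC, ht] with n hn h1
  calc ‖a ^ n‖ ≤ C * (min (ε / 2) (1/2)) ^ n := hn
    _ ≤ |C| * (ε / 2) ^ n := by
      gcongr
      · exact le_abs_self C
      · exact min_le_left _ _
    _ = (|C| * (1/2) ^ n) * ε ^ n := by rw [div_eq_mul_one_div, mul_pow]; ring
    _ ≤ 1 * ε ^ n := by gcongr
    _ = ε ^ n := one_mul _

lemma gdrazin_conj {a b u v : A} (huv : u * v = 1) (hvu : v * u = 1)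
    (h : IsGDrazinInverse a b) : IsGDrazinInverse (u * a * v) (u * b * v) := by
  obtain ⟨h1, h2, h3⟩ := h
  have key : ∀ x y : A, (u * x * v) * (u * y * v) = u * (x * y) * v := by
    intro x y
    calc (u * x * v) * (u * y * v) = u * x * (v * u) * y * v := by noncomm_ring
      _ = u * (x * y) * v := by rw [hvu]; noncomm_ring
  have keyp : ∀ (x : A) (n : ℕ), (u * x * v) ^ n = u * x ^ n * v := by
    intro x n
    induction n with
    | zero => simp [huv]
    | succ n ih => rw [pow_succ, ih, key, ← pow_succ]
  refine ⟨by rw [key, key, h1], by rw [key, key, h2], ?_⟩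
  have e : u * a * v - (u * a * v) ^ 2 * (u * b * v) = u * (a - a ^ 2 * b) * v := by
    rw [keyp, key, mul_sub, sub_mul]
  rw [e]
  apply qn_of_bound
  intro ε hε _
  refine ⟨‖u‖ * ‖v‖, ?_⟩
  filter_upwards [(qn_iff _).1 h3 ε hε] with n hn
  rw [keyp]
  calc _ ≤ ‖u‖ * ‖(a - a ^ 2 * b) ^ n‖ * ‖v‖ := by
        refine (norm_mul_le _ _).trans ?_
        gcongr
        exact norm_mul_le _ _
    _ ≤ ‖u‖ * ε ^ n * ‖v‖ := by gcongr
    _ = _ := by ring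

variable [NormedAlgebra ℂ A] [CompleteSpace A]

lemma qn_isUnit {q : A} (hq : IsQuasinilpotent q) {z : ℂ} (hz : z ≠ 0) :
    IsUnit (algebraMap ℂ A z - q) := by
  have hz' : 0 < ‖z‖ := norm_pos_iff.2 hz
  obtain ⟨n, hn, hn0⟩ := (((qn_iff q).1 hq (‖z‖ / 2) (by positivity)).and
    (eventually_gt_atTop 0)).exists
  set x : A := z⁻¹ • q with hx
  have hxn : ‖x ^ n‖ < 1 := by
    rw [hx, smul_pow, norm_smul, norm_pow, norm_inv]
    calc _ ≤ ‖z‖⁻¹ ^ n * (‖z‖ / 2) ^ n := by gcongr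
      _ = (1/2) ^ n := by rw [← mul_pow]; congr 1; field_simp
      _ < 1 := pow_lt_one₀ (by norm_num) (by norm_num) hn0.ne'
  have hu : IsUnit (1 - x ^ n) := isUnit_one_sub_of_norm_lt_one hxn
  have hc : Commute (1 - x) (∑ i ∈ Finset.range n, x ^ i) := by
    apply Commute.sum_right
    intro i _
    exact ((Commute.one_left _).sub_left (Commute.refl x)).pow_right i |> fun _ =>
      (Commute.one_left _).sub_left (Commute.self_pow x i)
  rw [← mul_neg_geom_sum x n] at hu
  have h1 := (hc.isUnit_mul_iff.1 hu).1
  have : algebraMap ℂ A z - q = algebraMap ℂ A z * (1 - x) := by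
    rw [mul_sub, mul_one, hx, ← Algebra.smul_def, smul_smul, mul_inv_cancel₀ hz, one_smul]
  rw [this]
  exact ((isUnit_iff_ne_zero.2 hz).map (algebraMap ℂ A)).mul h1

lemma gdrazin_isUnit {a b : A} (h : IsGDrazinInverse a b) :
    ∀ᶠ z : ℂ in 𝓝[≠] 0, IsUnit (algebraMap ℂ A z - a) := by
  obtain ⟨h1, h2, h3⟩ := h
  have hnb : ∀ᶠ z : ℂ in 𝓝[≠] 0, IsUnit (1 - algebraMap ℂ A z * b) := by
    apply Filter.Eventually.filter_mono nhdsWithin_le_nhds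
    have hcont : Continuous (fun z : ℂ => 1 - algebraMap ℂ A z * b) := by fun_prop
    exact hcont.continuousAt.eventually (Units.isOpen.mem_nhds (by simp))
  filter_upwards [hnb, self_mem_nhdsWithin] with z hz hz0
  have hq := qn_isUnit h3 hz0
  set c := algebraMap ℂ A z with hc
  have cc : ∀ x : A, c * x = x * c := fun x => Algebra.commutes z x
  obtain ⟨U, hU⟩ := hz
  obtain ⟨V, hV⟩ := hq
  -- `c - a = (p + ...)`
  have e2 : (a*b) * (a*b) = a*b := by rw [mul_assoc, ← mul_assoc b, h2]
  -- factor: c - a = (c - a p) * (p + q (c - a)) up to units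
  have f1 : (V:A) = c - a * (1 - a * b) := by rw [hV]; noncomm_ring
  have ca : Commute (a*b) a := by
    show a * b * a = a * (a * b); rw [mul_assoc, ← h1]
  have cq : Commute (a*b) (V:A) := by
    rw [f1]
    refine Commute.sub_right (cc _).symm (ca.mul_right ?_)
    exact (Commute.one_right _).sub_right (Commute.refl _)
  have cqi : Commute (a*b) (↑V⁻¹:A) := cq.units_inv_right
  have cb : Commute (a*b) b := by
    show a * b * b = b * (a * b); rw [h1, mul_assoc, h1]
  have cU : Commute (a*b) (U:A) := by
    rw [hU]
    exact (Commute.one_right _).sub_right (Commute.mul_right (cc _).symm cb)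
  have cUi : Commute (a*b) (↑U⁻¹:A) := cU.units_inv_right
  have aU : Commute a (U:A) := by
    rw [hU]
    exact (Commute.one_right _).sub_right (Commute.mul_right (cc _).symm h1)
  have aUi := aU.units_inv_right
  have bU : Commute b (U:A) := by
    rw [hU]
    exact (Commute.one_right _).sub_right (Commute.mul_right (cc _).symm (Commute.refl b))
  have bUi := bU.units_inv_right
  have aV : Commute a (V:A) := by
    rw [f1]
    refine Commute.sub_right (cc _).symm ((Commute.refl a).mul_right ?_)
    exact (Commute.one_right _).sub_right ca.symm
  have aVi := aV.units_inv_right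
  -- the inverse
  set W : A := (1 - a*b) * ↑V⁻¹ - b * ↑U⁻¹ with hW
  have hbq : a * b * b = b := by rw [h1]; exact h2
  have r1 : (c - a) * (1 - a*b) = (1 - a*b) * V := by
    have e3 : (1 - a * b) * (1 - a * b) = 1 - a * b := by
      have : (1 - a * b) * (1 - a * b) = 1 - a * b - a * b + (a * b) * (a * b) := by noncomm_ring
      rw [this, e2]; noncomm_ring
    have e4 : (1 - a * b) * (V : A) = V * (1 - a * b) :=
      ((Commute.one_left _).sub_left cq).eq
    rw [e4, f1, sub_mul, sub_mul, mul_assoc a, e3]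
  have r2 : (c - a) * b = - (a * b) * U := by
    rw [hU]
    have : -(a*b) * (1 - c * b) = (a * b * c) * b - a * b := by noncomm_ring
    rw [this, ← cc, mul_assoc c, hbq, sub_mul]
  have hr : (c - a) * W = 1 := by
    rw [hW, mul_sub, ← mul_assoc, r1, ← mul_assoc, r2, mul_assoc, V.mul_inv, mul_assoc, U.mul_inv]
    noncomm_ring
  have hcomm : Commute (c - a) W := by
    apply Commute.sub_left (cc _)
    rw [hW]
    refine Commute.sub_right ?_ ?_
    · exact ((Commute.one_right _).sub_right ca.symm).mul_right aVi
    · exact Commute.mul_right h1 aUi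
  exact ⟨⟨c - a, W, hr, hcomm.eq ▸ hr⟩, rfl⟩

end aux

section spec
variable {A : Type*} [NormedRing A] [NormedAlgebra ℂ A] [CompleteSpace A]

lemma clm_circleIntegral (L : A →L[ℂ] A) {f : ℂ → A} {r : ℝ} (hf : CircleIntegrable f 0 r) :
    L (∮ z in C(0, r), f z) = ∮ z in C(0, r), L (f z) := by
  unfold circleIntegral
  rw [← ContinuousLinearMap.intervalIntegral_comp_comm L hf.out]
  simp

lemma gdrazin_of_isUnit {a : A}
    (h : ∀ᶠ z : ℂ in 𝓝[≠] 0, IsUnit (algebraMap ℂ A z - a)) : ∃ b, IsGDrazinInverse a b := by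
  obtain ⟨R₀, hR₀, hU⟩ := Metric.mem_nhdsWithin_iff.1 h
  set R := R₀ / 2 with hRdef
  have hR : 0 < R := by positivity
  clear_value R
  have hU' : ∀ z : ℂ, z ≠ 0 → ‖z‖ ≤ R → IsUnit (algebraMap ℂ A z - a) := by
    intro z hz hzR
    refine hU ⟨?_, hz⟩
    rw [mem_ball_zero_iff]; linarith
  have hd : ∀ (n : ℤ) (z : ℂ), z ≠ 0 → ‖z‖ ≤ R →
      DifferentiableAt ℂ (fun z : ℂ => z ^ n • resolvent a z) z := by
    intro n z hz hzR
    exact (differentiableAt_zpow.2 (Or.inl hz)).smul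
      (spectrum.hasDerivAt_resolvent_const_left (hU' z hz hzR)).differentiableAt
  let J : ℝ → ℤ → A := fun r n => ∮ z in C(0, r), z ^ n • resolvent a z
  have hint : ∀ r : ℝ, 0 < r → r ≤ R → ∀ n : ℤ,
      CircleIntegrable (fun z : ℂ => z ^ n • resolvent a z) 0 r := by
    intro r hr hrR n
    apply ContinuousOn.circleIntegrable hr.le
    intro z hz
    have hz' : ‖z‖ = r := by simpa using hz
    exact (hd n z (by rintro rfl; simp at hz'; linarith)
      (by linarith)).continuousAt.continuousWithinAt
  have hJr : ∀ r : ℝ, 0 < r → r ≤ R → ∀ n : ℤ, J R n = J r n := by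
    intro r hr hrR n
    apply Complex.circleIntegral_eq_of_differentiable_on_annulus_off_countable hr hrR
      Set.countable_empty
    · rintro z ⟨hz1, hz2⟩
      have h1 : ‖z‖ ≤ R := by simpa using hz1
      have h2 : r ≤ ‖z‖ := by simpa using hz2
      exact (hd n z (norm_pos_iff.1 (by linarith)) h1).continuousAt.continuousWithinAt
    · rintro z ⟨⟨hz1, hz2⟩, -⟩
      have h1 : ‖z‖ < R := by simpa using hz1
      have h2 : r < ‖z‖ := by simpa using hz2
      exact hd n z (norm_pos_iff.1 (by linarith)) h1.le
  have hbd : ∀ r : ℝ, 0 < r → r ≤ R → ∃ C : ℝ, ∀ n : ℤ, ‖J R n‖ ≤ C * r ^ n := by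
    intro r hr hrR
    have hcont : ContinuousOn (fun z : ℂ => resolvent a z) (Metric.sphere 0 r) := by
      intro z hz
      have hz' : ‖z‖ = r := by simpa using hz
      exact (spectrum.hasDerivAt_resolvent_const_left (hU' z
        (by rintro rfl; simp at hz'; linarith)
        (by linarith))).continuousAt.continuousWithinAt
    obtain ⟨C, hC⟩ := (isCompact_sphere (0:ℂ) r).exists_bound_of_continuousOn hcont
    refine ⟨2 * Real.pi * r * C, fun n => ?_⟩
    rw [hJr r hr hrR n]
    have := circleIntegral.norm_integral_le_of_norm_le_const
      (f := fun z : ℂ => z ^ n • resolvent a z) (c := 0) (C := r ^ n * C) hr.le (by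
        intro z hz
        have hz' : ‖z‖ = r := by simpa using hz
        rw [norm_smul, norm_zpow, hz']
        gcongr
        exact hC z hz)
    calc _ ≤ _ := this
      _ = _ := by ring
  have hres : ∀ z : ℂ, z ≠ 0 → ‖z‖ ≤ R →
      a * resolvent a z = z • resolvent a z - 1 ∧ resolvent a z * a = z • resolvent a z - 1 := by
    intro z hz hzR
    have h1 := Ring.mul_inverse_cancel _ (hU' z hz hzR)
    have h2 := Ring.inverse_mul_cancel _ (hU' z hz hzR)
    change (algebraMap ℂ A z - a) * resolvent a z = 1 at h1
    change resolvent a z * (algebraMap ℂ A z - a) = 1 at h2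
    rw [sub_mul, ← Algebra.smul_def] at h1
    rw [mul_sub, ← Algebra.commutes, ← Algebra.smul_def] at h2
    constructor
    · rw [← h1]; abel
    · rw [← h2]; abel
  have hrec0 : ∀ n : ℤ, (∮ z in C(0, R), (z ^ (n+1) • resolvent a z - (z ^ n) • (1:A)))
      = J R (n+1) - (∮ z in C(0, R), (z:ℂ) ^ n) • (1:A) := by
    intro n
    rw [circleIntegral.integral_sub (hint R hR le_rfl _), circleIntegral.integral_smul_const]
    apply ContinuousOn.circleIntegrable hR.le
    intro z hz
    have hz' : ‖z‖ = R := by simpa using hz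
    have hz0 : z ≠ 0 := by rintro rfl; simp at hz'; linarith
    exact ((continuousAt_zpow₀ z n (Or.inl hz0)).smul
      continuousAt_const).continuousWithinAt
  have hL : ∀ n : ℤ, a * J R n = J R (n+1) - (∮ z in C(0, R), (z:ℂ) ^ n) • (1:A) := by
    intro n
    rw [← hrec0]
    have := clm_circleIntegral (ContinuousLinearMap.mul ℂ A a) (hint R hR le_rfl n)
    rw [ContinuousLinearMap.mul_apply'] at this
    refine this.trans (circleIntegral.integral_congr hR.le ?_)
    intro z hz
    have hz' : ‖z‖ = R := by simpa using hz
    have hz0 : z ≠ 0 := by rintro rfl; simp at hz'; linarith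
    simp only [ContinuousLinearMap.mul_apply', mul_smul_comm]
    rw [(hres z hz0 hz'.le).1, smul_sub, smul_smul, zpow_add_one₀ hz0]
  have hRt : ∀ n : ℤ, J R n * a = J R (n+1) - (∮ z in C(0, R), (z:ℂ) ^ n) • (1:A) := by
    intro n
    rw [← hrec0]
    have := clm_circleIntegral ((ContinuousLinearMap.mul ℂ A).flip a) (hint R hR le_rfl n)
    rw [ContinuousLinearMap.flip_apply, ContinuousLinearMap.mul_apply'] at this
    refine this.trans (circleIntegral.integral_congr hR.le ?_)
    intro z hz
    have hz' : ‖z‖ = R := by simpa using hz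
    have hz0 : z ≠ 0 := by rintro rfl; simp at hz'; linarith
    simp only [ContinuousLinearMap.flip_apply, ContinuousLinearMap.mul_apply', smul_mul_assoc]
    rw [(hres z hz0 hz'.le).2, smul_sub, smul_smul, zpow_add_one₀ hz0]
  have hzp : ∀ n : ℤ, n ≠ -1 → (∮ z in C(0, R), (z:ℂ) ^ n) = 0 := by
    intro n hn
    simpa using circleIntegral.integral_sub_zpow_of_ne hn 0 0 R
  have hz1 : (∮ z in C(0, R), (z:ℂ) ^ (-1:ℤ)) = 2 * Real.pi * Complex.I := by
    simpa using circleIntegral.integral_sub_center_inv 0 hR.ne'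
  set k : ℂ := 2 * Real.pi * Complex.I with hk
  have hk0 : k ≠ 0 := Complex.two_pi_I_ne_zero
  have hpos : ∀ n : ℕ, a ^ n * J R 0 = J R n := by
    intro n
    induction n with
    | zero => simp
    | succ n ih =>
      rw [pow_succ', mul_assoc, ih, hL, hzp _ (by omega)]; simp
  have hneg : ∀ n : ℕ, J R (-1) = J R (-1 - n) * a ^ n := by
    intro n
    induction n with
    | zero => simp
    | succ n ih =>
      rw [pow_succ', ← mul_assoc, hRt, hzp _ (by push_cast; omega), ih]
      congr 1
      simp only [zero_smul, sub_zero]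
      congr 1
      push_cast; ring
  have hzero : J R (-1) * J R 0 = 0 := by
    obtain ⟨C1, hC1⟩ := hbd R hR le_rfl
    obtain ⟨C2, hC2⟩ := hbd (R/2) (by positivity) (by linarith)
    have hb : ∀ n : ℕ, ‖J R (-1) * J R 0‖ ≤ (C1 * R⁻¹ * C2) * (1/2) ^ n := by
      intro n
      rw [hneg n, mul_assoc, hpos]
      calc _ ≤ ‖J R (-1 - n)‖ * ‖J R n‖ := norm_mul_le _ _
        _ ≤ (C1 * R ^ (-1 - n : ℤ)) * (C2 * (R/2) ^ (n:ℤ)) :=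
          mul_le_mul (hC1 _) (hC2 _) (norm_nonneg _) ((norm_nonneg _).trans (hC1 _))
        _ = _ := by
          rw [zpow_sub₀ hR.ne', zpow_natCast, zpow_natCast, div_pow R 2, div_pow 1 2, one_pow]
          field_simp
    have ht : Tendsto (fun n : ℕ => (C1 * R⁻¹ * C2) * (1/2 : ℝ) ^ n) atTop (𝓝 0) := by
      simpa using (tendsto_pow_atTop_nhds_zero_of_lt_one (r := (1/2:ℝ)) (by norm_num)
        (by norm_num)).const_mul (C1 * R⁻¹ * C2)
    exact norm_le_zero_iff.1 (ge_of_tendsto' ht hb)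
  have hm1 : a * J R (-1) = J R 0 - k • (1:A) := by rw [hL, hz1]; simp
  have hm1' : J R (-1) * a = J R 0 - k • (1:A) := by rw [hRt, hz1]; simp
  have hab : a * (-(k⁻¹ • J R (-1))) = 1 - k⁻¹ • J R 0 := by
    rw [mul_neg, mul_smul_comm, hm1, smul_sub, smul_smul, inv_mul_cancel₀ hk0, one_smul]; abel
  have hba : (-(k⁻¹ • J R (-1))) * a = 1 - k⁻¹ • J R 0 := by
    rw [neg_mul, smul_mul_assoc, hm1', smul_sub, smul_smul, inv_mul_cancel₀ hk0, one_smul]; abel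
  refine ⟨-(k⁻¹ • J R (-1)), hab.trans hba.symm, ?_, ?_⟩
  · rw [mul_assoc, hab, mul_sub, mul_one, neg_mul, smul_mul_smul_comm, hzero]; simp
  · have e : a - a ^ 2 * (-(k⁻¹ • J R (-1))) = a * (k⁻¹ • J R 0) := by
      rw [pow_two, mul_assoc, hab]; noncomm_ring
    rw [e]
    set p : A := k⁻¹ • J R 0 with hp
    have cap : Commute a p := by
      show a * p = p * a
      rw [hp, mul_smul_comm, smul_mul_assoc, hL, hRt]
    have hpp : p * p = p := by
      have : (-(k⁻¹ • J R (-1))) * p = 0 := by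
        rw [hp, neg_mul, smul_mul_smul_comm, hzero]; simp
      have h2 : a * (-(k⁻¹ • J R (-1))) * p = 0 := by rw [mul_assoc, this, mul_zero]
      rw [hab, sub_mul, one_mul, sub_eq_zero] at h2
      exact h2.symm
    apply qn_of_bound
    intro ε hε _
    obtain ⟨C, hC⟩ := hbd (min ε R) (by positivity) (min_le_right _ _)
    refine ⟨‖k⁻¹‖ * |C|, ?_⟩
    filter_upwards [eventually_gt_atTop 0] with n hn
    have hpn : p ^ n = p := IsIdempotentElem.pow_eq hpp hn.ne'
    rw [cap.mul_pow, hpn, hp, mul_smul_comm, hpos, norm_smul, mul_assoc]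
    gcongr
    calc _ ≤ _ := hC n
      _ ≤ |C| * ε ^ n := by
        rw [zpow_natCast]
        gcongr
        · exact le_abs_self C
        · exact min_le_left _ _
end spec

section fin
variable {X : Type*} [NormedAddCommGroup X] [NormedSpace ℂ X]

lemma blk_mul (a b c d a' b' c' d' : X →L[ℂ] X) :
    blk a b c d * blk a' b' c' d' =
      blk (a * a' + b * c') (a * b' + b * d') (c * a' + d * c') (c * b' + d * d') := by
  ext x <;> simp [blk]

lemma blk_one : blk (1 : X →L[ℂ] X) 0 0 1 = 1 := by
  ext x <;> simp [blk]

lemma blk_sub (z : ℂ) (E F : X →L[ℂ] X) :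
    algebraMap ℂ ((X × X) →L[ℂ] (X × X)) z - blk E F 1 0 =
      blk (algebraMap ℂ (X →L[ℂ] X) z - E) (-F) (-1) (algebraMap ℂ (X →L[ℂ] X) z) := by
  ext x <;> simp [blk, Algebra.algebraMap_eq_smul_one]

lemma blk_isUnit (z : ℂ) (E F : X →L[ℂ] X)
    (h : IsUnit (algebraMap ℂ (X →L[ℂ] X) z * algebraMap ℂ (X →L[ℂ] X) z
      - algebraMap ℂ (X →L[ℂ] X) z * E - F)) :
    IsUnit (algebraMap ℂ ((X × X) →L[ℂ] (X × X)) z - blk E F 1 0) := by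
  rw [blk_sub]
  have cc : ∀ x, algebraMap ℂ (X →L[ℂ] X) z * x = x * algebraMap ℂ (X →L[ℂ] X) z :=
    fun x => Algebra.commutes z x
  generalize algebraMap ℂ (X →L[ℂ] X) z = c at *
  obtain ⟨P, hP⟩ := h
  have hP' : (P : X →L[ℂ] X) = (c - E) * c - F := by rw [hP, sub_mul, cc E]
  have h1 : ((c - E) * c - F) * (↑P⁻¹ : X →L[ℂ] X) = 1 := by rw [← hP']; exact P.mul_inv
  have h2 : (↑P⁻¹ : X →L[ℂ] X) * ((c - E) * c - F) = 1 := by rw [← hP']; exact P.inv_mul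
  generalize (↑P⁻¹ : X →L[ℂ] X) = W at *
  refine ⟨⟨blk (c - E) (-F) (-1) c, blk (c * W) (c * W * (c - E) - 1) W (W * (c - E)), ?_, ?_⟩, rfl⟩
  · rw [blk_mul, ← blk_one]
    congr 1
    · rw [← h1]; noncomm_ring
    · calc _ = (((c - E) * c - F) * W) * (c - E) - (c - E) := by noncomm_ring
        _ = 0 := by rw [h1]; noncomm_ring
    · noncomm_ring
    · noncomm_ring
  · rw [blk_mul, ← blk_one]
    congr 1
    · calc _ = c * W * (c - E) - c * W * (c - E) + 1 := by noncomm_ring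
        _ = 1 := by noncomm_ring
    · calc _ = c * (W * ((c - E) * c - F)) - c := by noncomm_ring
        _ = 0 := by rw [h2]; noncomm_ring
    · noncomm_ring
    · calc _ = W * ((c - E) * c - F) := by noncomm_ring
        _ = 1 := h2

/-- The operator pencil is invertible near zero. -/
lemma pencil_isUnit {A : Type*} [NormedRing A] [NormedAlgebra ℂ A] [CompleteSpace A]
    (E F Fd : A) (hF : IsGDrazinInverse F Fd)
    (hEFpi : ∃ y, IsGDrazinInverse (E * (1 - F * Fd)) y)
    (h1 : (1 - F * Fd) * E * F ^ 2 = 0)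
    (h2 : (1 - F * Fd) * E * F * E = 0) :
    ∀ᶠ z : ℂ in 𝓝[≠] 0, IsUnit (algebraMap ℂ A z * algebraMap ℂ A z
      - algebraMap ℂ A z * E - F) := by
  obtain ⟨hc, hb, hq⟩ := hF
  obtain ⟨y, hy⟩ := hEFpi
  obtain ⟨p, hp⟩ : ∃ p, p = 1 - F * Fd := ⟨_, rfl⟩
  have hss : (F * Fd) * (F * Fd) = F * Fd := by rw [mul_assoc, ← mul_assoc Fd, hb]
  have hpp : p * p = p := by
    have : p * p = 1 - F * Fd - F * Fd + (F * Fd) * (F * Fd) := by rw [hp]; noncomm_ring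
    rw [this, hss, hp]; noncomm_ring
  have hpF : p * F = F * p := by
    have : F * Fd * F = F * (F * Fd) := by rw [mul_assoc, ← hc]
    rw [hp, sub_mul, mul_sub, this]; simp
  have hpFd : p * Fd = 0 := by rw [hp, sub_mul, one_mul, hc, hb, sub_self]
  have hFdp : Fd * p = 0 := by rw [hp, mul_sub, mul_one, ← mul_assoc, hb, sub_self]
  have hs : F * Fd = 1 - p := by rw [hp]; abel
  rw [← hp] at h1 h2 hy
  have hpEp : p * E * p = p * E := by
    have e : F * Fd = F ^ 2 * (Fd * Fd) := by
      rw [← hss]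
      calc F * Fd * (F * Fd) = F * (Fd * F) * Fd := by noncomm_ring
        _ = F ^ 2 * (Fd * Fd) := by rw [← hc]; noncomm_ring
    have : p * E * (F * Fd) = 0 := by rw [e, ← mul_assoc, h1, zero_mul]
    rw [hs, mul_sub, mul_one, sub_eq_zero] at this
    exact this.symm
  have hq' : IsQuasinilpotent (p * F) := by
    have : p * F = F - F ^ 2 * Fd := by rw [hpF, hp]; noncomm_ring
    rwa [this]
  -- second factor
  have hu2 : ∀ᶠ z : ℂ in 𝓝[≠] 0, IsUnit (p + (1 - p) *
      (algebraMap ℂ A z * algebraMap ℂ A z - algebraMap ℂ A z * E - F)) := by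
    apply Filter.Eventually.filter_mono nhdsWithin_le_nhds
    have hcont : Continuous (fun z : ℂ => p + (1 - p) *
      (algebraMap ℂ A z * algebraMap ℂ A z - algebraMap ℂ A z * E - F)) := by fun_prop
    refine hcont.continuousAt.eventually (Units.isOpen.mem_nhds ?_)
    simp only [map_zero, zero_mul, zero_sub, sub_zero]
    refine ⟨⟨_, p - Fd, ?_, ?_⟩, rfl⟩
    · calc (p + (1 - p) * -F) * (p - Fd)
          = p * p - p * Fd - F * p + p * F * p + (F * Fd) - p * (F * Fd) := by noncomm_ring
        _ = 1 := by rw [hs, hpF, hpFd, mul_assoc, mul_sub, hpp]; noncomm_ring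
    · calc (p - Fd) * (p + (1 - p) * -F)
          = p * p - p * F + p * p * F - Fd * p + Fd * F - Fd * p * F := by noncomm_ring
        _ = 1 := by rw [hFdp, hpp, ← hc, hs]; noncomm_ring
  filter_upwards [hu2, gdrazin_isUnit hy, self_mem_nhdsWithin] with z hz2 hzE hz0
  have hz0' : z ≠ 0 := hz0
  -- resolvent of `p * E`
  have hzE' : IsUnit (algebraMap ℂ A z - p * E) := by
    have h := spectrum.unit_mem_mul_comm (R := ℂ) (a := p) (b := E * p) (r := Units.mk0 z hz0')
    rw [mul_assoc E, hpp, ← mul_assoc, hpEp] at h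
    simp only [Units.val_mk0, spectrum.mem_iff] at h
    exact (not_iff_not.1 h).2 hzE
  have hzF : IsUnit (algebraMap ℂ A (z * z) - p * F) := qn_isUnit hq' (mul_ne_zero hz0' hz0')
  rw [map_mul] at hzF
  have cc : ∀ x, algebraMap ℂ A z * x = x * algebraMap ℂ A z := fun x => Algebra.commutes z x
  have dd : ∀ x, algebraMap ℂ A z⁻¹ * x = x * algebraMap ℂ A z⁻¹ := fun x => Algebra.commutes _ x
  have hcd : algebraMap ℂ A z * algebraMap ℂ A z⁻¹ = 1 := by
    rw [← map_mul, mul_inv_cancel₀ hz0', map_one]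
  have hdc : algebraMap ℂ A z⁻¹ * algebraMap ℂ A z = 1 := by rw [dd, hcd]
  generalize algebraMap ℂ A z = c at *
  generalize algebraMap ℂ A z⁻¹ = d at *
  have hdU : IsUnit d := ⟨⟨d, c, hdc, hcd⟩, rfl⟩
  -- `e f e = 0`, `e f f = 0`
  have efe : p * E * (p * F) * (p * E) = 0 := by
    calc p * E * (p * F) * (p * E) = p * E * (p * (F * p)) * E := by noncomm_ring
      _ = (p * E * p * p) * F * E := by rw [← hpF]; noncomm_ring
      _ = 0 := by rw [hpEp, hpEp, h2]
  have eff : p * E * (p * F) * (p * F) = 0 := by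
    calc p * E * (p * F) * (p * F) = p * E * (p * (F * p)) * F := by noncomm_ring
      _ = (p * E * p * p) * F ^ 2 := by rw [← hpF]; noncomm_ring
      _ = 0 := by rw [hpEp, hpEp, h1]
  have efU : ∀ t : A, (∀ x, t * x = x * t) → (1 + t * (p * E * (p * F))) *
      (1 - t * (p * E * (p * F))) = 1 := by
    intro t ht
    calc _ = 1 - t * ((p * E * (p * F)) * t) * (p * E * (p * F)) := by noncomm_ring
      _ = 1 - t * (t * (p * E * (p * F))) * (p * E * (p * F)) := by rw [ht (p * E * (p * F))]
      _ = 1 - t * t * (p * E * (p * F) * (p * E) * (p * F)) := by noncomm_ring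
      _ = 1 := by rw [efe]; simp
  have hQ : IsUnit (c * c - c * (p * E) - p * F) := by
    have ht : ∀ x, (d * d * d) * x = x * (d * d * d) := fun x =>
      Commute.mul_left (Commute.mul_left (dd x) (dd x)) (dd x)
    generalize p * E = e at *
    generalize p * F = f at *
    have u1 : IsUnit (1 - (d * d * d) * (e * f)) := by
      refine ⟨⟨_, 1 + (d * d * d) * (e * f), ?_, efU _ ht⟩, rfl⟩
      have := efU (-(d * d * d)) (by intro x; rw [neg_mul, mul_neg, ht])
      simpa [sub_eq_add_neg] using this
    have k1 : (c - e) * (c * c - f) = c * (c * c - c * e - f) + e * f := by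
      calc (c - e) * (c * c - f) = c * c * c - c * f - (e * c) * c + e * f := by noncomm_ring
        _ = c * c * c - c * f - c * c * e + e * f := by rw [← cc e, mul_assoc c e, ← cc e, mul_assoc c c e]
        _ = _ := by noncomm_ring
    have k2 : e * f * (c * c - c * e - f) = c * c * (e * f) := by
      calc e * f * (c * c - c * e - f) = (e * f * c) * c - (e * f * c) * e - e * f * f := by
            noncomm_ring
        _ = c * (e * f) * c - c * (e * f * e) - e * f * f := by
            rw [← cc (e * f), mul_assoc c (e * f) e]
        _ = c * (e * f * c) := by rw [efe, eff]; noncomm_ring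
        _ = _ := by rw [← cc (e * f), mul_assoc]
    have k3 : e * f * (e * f) = 0 := by rw [← mul_assoc, efe, zero_mul]
    have k4 : d * d * d * (c * c * (e * f)) = d * (e * f) := by
      calc d * d * d * (c * c * (e * f)) = d * (d * (d * c) * c) * (e * f) := by noncomm_ring
        _ = _ := by rw [hdc, mul_one, hdc, mul_one]
    have k5 : c * c - c * e - f = (1 - (d * d * d) * (e * f)) * (d * ((c - e) * (c * c - f))) := by
      rw [k1, mul_add, ← mul_assoc d c, hdc, one_mul]
      calc c * c - c * e - f = (c * c - c * e - f) + d * (e * f) - d * (e * f) - 0 := by abel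
        _ = (c * c - c * e - f) + d * (e * f) - d * d * d * (e * f * (c * c - c * e - f))
            - d * d * d * (d * (e * f * (e * f))) := by rw [k2, k4, k3]; simp
        _ = (c * c - c * e - f) + d * (e * f) - d * d * d * (e * f * (c * c - c * e - f))
            - d * d * d * ((e * f * d) * (e * f)) := by rw [← dd (e * f)]; noncomm_ring
        _ = _ := by noncomm_ring
    rw [k5]
    exact u1.mul (hdU.mul (hzE'.mul hzF))
  have hG : IsUnit (p * (c * c - c * E - F) + (1 - p)) := by
    have g1 : p * (c * c - c * E - F) + (1 - p)
        = (d * d * (1 - p) + p) * (c * c - c * (p * E) - p * F) := by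
      have q1 : p * (c * c - c * (p * E) - p * F) = p * (c * c - c * E - F) := by
        calc _ = p * c * c - p * c * p * E - p * p * F := by noncomm_ring
          _ = p * c * c - c * (p * p) * E - p * p * F := by rw [← cc p]; noncomm_ring
          _ = p * c * c - c * p * E - p * F := by rw [hpp]
          _ = _ := by rw [cc p]; noncomm_ring
      have q2 : (1 - p) * (c * c - c * (p * E) - p * F) = c * c * (1 - p) := by
        calc _ = c * c - p * c * c - c * p * E + p * c * p * E - p * F + p * p * F := by
              noncomm_ring
          _ = c * c - c * p * c - c * p * E + c * (p * p) * E - p * F + p * p * F := by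
              rw [← cc p]; noncomm_ring
          _ = c * c - c * (p * c) := by rw [hpp]; noncomm_ring
          _ = _ := by rw [← cc p]; noncomm_ring
      rw [add_mul, q1, mul_assoc, q2]
      have : d * d * (c * c * (1 - p)) = 1 - p := by
        calc _ = d * (d * c) * c * (1 - p) := by noncomm_ring
          _ = _ := by rw [hdc, mul_one, hdc, one_mul]
      rw [this, add_comm]
    rw [g1]
    refine IsUnit.mul ?_ hQ
    have key : ∀ s t : A, s * t = 1 → (∀ x, t * x = x * t) →
        (s * (1 - p) + p) * (t * (1 - p) + p) = 1 := by
      intro s t hst ht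
      calc _ = s * t * (1 - p) - s * (p * t) * (1 - p) + s * (p - p * p) + p * t * (1 - p)
            + p * p := by noncomm_ring
        _ = s * t * (1 - p) - s * t * (p - p * p) + s * (p - p * p) + t * (p - p * p)
            + p * p := by rw [← ht p]; noncomm_ring
        _ = 1 := by rw [hpp, hst]; noncomm_ring
    have hdd : d * d * (c * c) = 1 := by
      rw [mul_assoc, ← mul_assoc d c c, hdc, one_mul, hdc]
    have hcc : c * c * (d * d) = 1 := by
      rw [mul_assoc, ← mul_assoc c d d, hcd, one_mul, hcd]
    exact ⟨⟨_, c * c * (1 - p) + p, key _ _ hdd (fun x => Commute.mul_left (cc x) (cc x)),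
      key _ _ hcc (fun x => Commute.mul_left (dd x) (dd x))⟩, rfl⟩
  have hfin : c * c - c * E - F = (p * (c * c - c * E - F) + (1 - p)) *
      (p + (1 - p) * (c * c - c * E - F)) := by
    have hPp : p * (c * c - c * E - F) * p = p * (c * c - c * E - F) := by
      calc _ = (p * c) * (c * p) - (p * c) * E * p - p * F * p := by noncomm_ring
        _ = (c * p) * (c * p) - (c * p) * E * p - F * p * p := by rw [← cc p, hpF]
        _ = (c * p) * (p * c) - (c * p) * E * p - F * p * p := by
            rw [← cc p]
        _ = c * (p * p) * c - c * (p * E * p) - F * (p * p) := by noncomm_ring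
        _ = (c * p) * c - (c * p) * E - F * p := by rw [hpEp, hpp]; noncomm_ring
        _ = (p * c) * c - (p * c) * E - p * F := by rw [hpF, ← cc p]
        _ = _ := by noncomm_ring
    generalize c * c - c * E - F = P at *
    calc P = p * P + (p * P - p * P) * P + (p - p) + (P - p * P) - (p - p) * P := by noncomm_ring
      _ = p * P * p + (p * P - p * P * p) * P + (p - p * p) + (P - p * P)
          - (p - p * p) * P := by rw [hPp, hpp]
      _ = _ := by noncomm_ring
  rw [hfin]
  exact hG.mul hz2
end fin

theorem stmt15 {X : Type*} [NormedAddCommGroup X] [NormedSpace ℂ X] [CompleteSpace X]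
    (E F Fd : X →L[ℂ] X) (hF : IsGDrazinInverse F Fd)
    (hE : ∃ e, IsGDrazinInverse E e)
    (hEFpi : ∃ y, IsGDrazinInverse (E * (1 - F * Fd)) y)
    (h1 : (1 - F * Fd) * E * F ^ 2 = 0)
    (h2 : (1 - F * Fd) * E * F * E = 0) :
    (∃ y, IsGDrazinInverse (blk E F 1 0) y) ∧
      ∀ Md, IsGDrazinInverse (blk E 1 F 0) Md →
        IsGDrazinInverse (blk E F 1 0) (blk E 1 1 0 * Md * blk 0 1 1 (-E)) := by
  constructor
  · apply gdrazin_of_isUnit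
    filter_upwards [pencil_isUnit E F Fd hF hEFpi h1 h2] with z hz
    exact blk_isUnit z E F hz
  · intro Md hMd
    have huv : blk E 1 1 0 * blk 0 1 1 (-E) = 1 := by
      rw [blk_mul, ← blk_one]; congr 1 <;> noncomm_ring
    have hvu : blk 0 1 1 (-E) * blk E 1 1 0 = 1 := by
      rw [blk_mul, ← blk_one]; congr 1 <;> noncomm_ring
    have e : blk E F 1 0 = blk E 1 1 0 * blk E 1 F 0 * blk 0 1 1 (-E) := by
      rw [blk_mul, blk_mul]; congr 1 <;> noncomm_ring
    rw [e]
    exact gdrazin_conj huv hvu hMd
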